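/- arXiv:1309.3779 — 2 statements merged into one kernel-verified Lean document; each statement's English description precedes it below -/
import Mathlib

section
/- Let n ≥ 2, let B_n' = [B_n, B_n] be the commutator subgroup of the braid group B_n (the kernel of the homomorphism B_n → ℤ sending every standard generator to 1), and let ℒ_q be the B_n-module ℚ[q^{±1}] on which every standard generator σ_i acts by multiplication by −q. Then for every j ≥ 0 there is an isomorphism of ℚ-vector spaces H^{j+1}(B_n; ℒ_q) ≅ H^j(B_n'; ℚ), where ℚ carries the trivial B_n'-action. -/
/-!
STATEMENT 16: For n ≥ 2, j ≥ 0, there is an isomorphism of ℚ-vector spaces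
H^{j+1}(B_n; ℒ_q) ≅ H^j(B_n'; ℚ), where B_n' = [B_n, B_n] is the commutator subgroup of
the braid group and ℒ_q = ℚ[q^{±1}] with each standard generator acting by
multiplication by −q.
-/

/-- The alternating word `s t s t ⋯` with `m` factors, as an element of the free group. -/
def braidWord {B : Type*} (s t : B) (m : ℕ) : FreeGroup B :=
  ((List.range m).map (fun i => if i % 2 = 0 then FreeGroup.of s else FreeGroup.of t)).prod

/-- The Artin relations associated to a Coxeter matrix `M`. -/
def artinRels {B : Type*} (M : CoxeterMatrix B) : Set (FreeGroup B) :=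
  {r | ∃ s t : B, s ≠ t ∧ M s t ≠ 0 ∧ r = braidWord s t (M s t) * (braidWord t s (M s t))⁻¹}

/-- The Artin group associated to a Coxeter matrix `M`. -/
def ArtinGroup {B : Type*} (M : CoxeterMatrix B) : Type _ := PresentedGroup (artinRels M)

instance {B : Type*} (M : CoxeterMatrix B) : Group (ArtinGroup M) :=
  QuotientGroup.Quotient.group _

/-- The standard generator `g_s` of the Artin group. -/
def artinGen {B : Type*} (M : CoxeterMatrix B) (s : B) : ArtinGroup M :=
  PresentedGroup.of s

/-- The braid group on `n` strands: the Artin group of type A_{n−1}. -/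
def BraidGroup (n : ℕ) : Type := ArtinGroup (CoxeterMatrix.Aₙ (n - 1))

instance (n : ℕ) : Group (BraidGroup n) :=
  inferInstanceAs (Group (ArtinGroup (CoxeterMatrix.Aₙ (n - 1))))

/-- The standard generator `σ_i` of the braid group. -/
def braidGen (n : ℕ) (i : Fin (n - 1)) : BraidGroup n := artinGen (CoxeterMatrix.Aₙ (n - 1)) i

open CategoryTheory Limits

universe u

theorem isZero_Ext_of_natTrans {k C : Type*} [Ring k] [Category* C] [Abelian C] [Linear k C]
    [EnoughProjectives C] (α : 𝟭 C ⟶ 𝟭 C) (X Y : C) (hX : α.app X = 0) [IsIso (α.app Y)] (n : ℕ) :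
    IsZero (((Ext k C n).obj (Opposite.op X)).obj Y) := by
  let P := projectiveResolution X
  let F := ((linearYoneda k C).obj Y).rightOp
  let φ : P.complex ⟶ P.complex :=
    { f i := α.app (P.complex.X i)
      comm' i j _ := (α.naturality (P.complex.d i j)).symm }
  have hφ : φ ≫ P.π = 0 := by
    ext
    change α.app (P.complex.X 0) ≫ (𝟭 C).map (P.π.f 0) = 0
    rw [← α.naturality]
    exact (congrArg (_ ≫ ·) hX).trans comp_zero
  have hcomp (i : ℕ) : IsIso (((F.mapHomologicalComplex _).map φ).f i) := by
    have : F.map (φ.f i) =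
        (((linearYoneda k C).map (α.app Y)).app (Opposite.op (P.complex.X i))).op := by
      apply Quiver.Hom.unop_inj
      ext f
      exact (α.naturality f).symm
    change IsIso (F.map (φ.f i))
    rw [this]
    infer_instance
  have : IsIso ((F.mapHomologicalComplex _).map φ) :=
    HomologicalComplex.Hom.isIso_of_components _
  have hzero : HomologicalComplex.homologyMap ((F.mapHomologicalComplex _).map φ) n = 0 := by
    have h := (F.mapHomotopy (ProjectiveResolution.liftHomotopyZero φ hφ)).homologyMap_eq n
    simpa using h
  have hz : IsZero (((F.mapHomologicalComplex _).obj P.complex).homology n) := by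
    rw [IsZero.iff_id_eq_zero, ← cancel_mono
      (HomologicalComplex.homologyMap ((F.mapHomologicalComplex _).map φ) n), hzero, comp_zero,
      comp_zero]
  exact (hz.of_iso (P.isoLeftDerivedObj F n)).unop

theorem isZero_groupCohomology_of_central {k G : Type u} [CommRing k] [Group G] (A : Rep.{u} k G)
    (z : G) (hz : ∀ g, Commute z g) (hA : Function.Bijective (fun a => A.ρ z a - a)) (n : ℕ) :
    IsZero (groupCohomology A n) := by
  let α : 𝟭 (Rep.{u} k G) ⟶ 𝟭 (Rep.{u} k G) :=
    { app M := Rep.ofHom ⟨M.ρ z - LinearMap.id, fun g => by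
        ext x
        have := congrArg (fun h => M.ρ h x) (hz g).eq
        simp only [map_mul, Module.End.mul_apply] at this
        simp [this]⟩
      naturality M N f := by
        ext x
        simp [Rep.hom_comm_apply] }
  have hiso : IsIso (α.app A) := by
    have : Mono (α.app A) := (Rep.mono_iff_injective _).2 hA.1
    have : Epi (α.app A) := (Rep.epi_iff_surjective _).2 hA.2
    exact isIso_of_mono_of_epi _
  refine (isZero_Ext_of_natTrans α (Rep.trivial k G k) A ?_ n).of_iso (groupCohomologyIsoExt A n)
  ext
  simp [α]

open scoped LaurentPolynomial LaurentSeries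
noncomputable section
variable {k : Type*} [Field k]

/-- The Laurent monomial `(-1)^m X^d`. -/
def signedMonomial (k : Type*) [Field k] (m d : ℤ) : k⸨X⸩ := HahnSeries.single d ((-1) ^ m)

theorem signedMonomial_mul (m m' d d' : ℤ) :
    signedMonomial k (m + m') (d + d') = signedMonomial k m d * signedMonomial k m' d' := by
  simp [signedMonomial, zpow_add₀]

theorem signedMonomial_zero : signedMonomial k 0 0 = 1 := by
  simp [signedMonomial]

theorem coeff_signedMonomial_mul (m d : ℤ) (a : k⸨X⸩) (i : ℤ) :
    (signedMonomial k m d * a).coeff i = (-1) ^ m * a.coeff (i - d) :=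
  HahnSeries.coeff_single_mul

/-- Multiplication by a signed Laurent monomial, as a linear map. -/
def signedMonomialMul (k : Type*) [Field k] (m d : ℤ) : k⸨X⸩ →ₗ[k] k⸨X⸩ where
  toFun a := signedMonomial k m d * a
  map_add' := mul_add _
  map_smul' c a := by
    ext i
    simp [coeff_signedMonomial_mul, mul_left_comm]

@[simp]
theorem signedMonomialMul_apply (m d : ℤ) (a : k⸨X⸩) :
    signedMonomialMul k m d a = signedMonomial k m d * a := rfl

theorem signedMonomial_ne_one {m d : ℤ} (hd : d ≠ 0) : signedMonomial k m d ≠ 1 := by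
  intro h
  have := congrArg (fun a => HahnSeries.coeff a 0) h
  simp [signedMonomial, HahnSeries.coeff_single_of_ne hd.symm] at this

variable {G : Type*} [Group G] (χ : G →* Multiplicative ℤ)

/-- The action on two copies of the Laurent series field, `-q` acting by `-X` on the
first and by `-X⁻¹` on the second. -/
def doubleLaurentRep (k : Type*) [Field k] {G : Type*} [Group G] (χ : G →* Multiplicative ℤ) :
    Representation k G (k⸨X⸩ × k⸨X⸩) where
  toFun g := (signedMonomialMul k (χ g).toAdd (χ g).toAdd).prodMap
    (signedMonomialMul k (χ g).toAdd (-(χ g).toAdd))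
  map_one' := by ext <;> simp [signedMonomial_zero]
  map_mul' g h := by
    ext <;> simp [signedMonomial_mul, neg_add, mul_assoc, -neg_add_rev]

theorem doubleLaurentRep_apply (g : G) (x : k⸨X⸩ × k⸨X⸩) :
    doubleLaurentRep k χ g x = (signedMonomial k (χ g).toAdd (χ g).toAdd * x.1,
      signedMonomial k (χ g).toAdd (-(χ g).toAdd) * x.2) := rfl

theorem bijective_doubleLaurentRep_sub {z : G} (hz : (χ z).toAdd ≠ 0) :
    Function.Bijective fun x => doubleLaurentRep k χ z x - x := by
  have h1 := sub_ne_zero.2 (signedMonomial_ne_one (k := k) (m := (χ z).toAdd) hz)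
  have h2 := sub_ne_zero.2
    (signedMonomial_ne_one (k := k) (m := (χ z).toAdd) (neg_ne_zero.2 hz))
  have : (fun x => doubleLaurentRep k χ z x - x) =
      Prod.map (fun a => (signedMonomial k (χ z).toAdd (χ z).toAdd - 1) * a)
        (fun b => (signedMonomial k (χ z).toAdd (-(χ z).toAdd) - 1) * b) := by
    ext x <;> simp [doubleLaurentRep_apply, sub_mul]
  rw [this]
  exact (mulLeft_bijective₀ _ h1).prodMap (mulLeft_bijective₀ _ h2)

/-- Expansion of Laurent polynomials at `0` and at `∞`. -/
def doubleExpansion (k : Type*) [Field k] : k[T;T⁻¹] →ₗ[k] k⸨X⸩ × k⸨X⸩ where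
  toFun p := (HahnSeries.ofFinsupp p.coeff, HahnSeries.ofFinsupp (p.coeff.equivMapDomain (.neg ℤ)))
  map_add' p q := by ext <;> simp
  map_smul' c p := by ext <;> simp

@[simp]
theorem coeff_doubleExpansion_fst (p : k[T;T⁻¹]) (i : ℤ) :
    (doubleExpansion k p).1.coeff i = p.coeff i := rfl

@[simp]
theorem coeff_doubleExpansion_snd (p : k[T;T⁻¹]) (i : ℤ) :
    (doubleExpansion k p).2.coeff i = p.coeff (-i) := rfl

theorem doubleExpansion_injective : Function.Injective (doubleExpansion k) := by
  intro p q h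
  ext i
  simpa using congrArg (fun x => x.1.coeff i) h

theorem exists_doubleExpansion_eq {x : k⸨X⸩ × k⸨X⸩} (hx : ∀ i, x.1.coeff i = x.2.coeff (-i)) :
    ∃ p, doubleExpansion k p = x := by
  have hfin : (Function.support x.1.coeff).Finite := by
    refine (Set.finite_Icc x.1.order (-x.2.order)).subset fun i hi => ⟨?_, ?_⟩
    · by_contra! h
      exact hi (HahnSeries.coeff_eq_zero_of_lt_order h)
    · by_contra! h
      exact hi ((hx i).trans (HahnSeries.coeff_eq_zero_of_lt_order (by lia)))
  refine ⟨.ofCoeff (Finsupp.ofSupportFinite x.1.coeff hfin), ?_⟩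
  ext i
  · rfl
  · exact (hx (-i)).trans (by rw [neg_neg])

theorem doubleExpansion_mul (c : k) (d : ℤ) (p : k[T;T⁻¹]) :
    doubleExpansion k (LaurentPolynomial.C c * LaurentPolynomial.T d * p) =
      (HahnSeries.single d c * (doubleExpansion k p).1,
        HahnSeries.single (-d) c * (doubleExpansion k p).2) := by
  have h (i : ℤ) : (LaurentPolynomial.C c * LaurentPolynomial.T d * p).coeff i =
      c * p.coeff (i - d) := by
    rw [← LaurentPolynomial.single_eq_C_mul_T]
    exact AddMonoidAlgebra.coeff_single_mul_eq_mul_coeff _ fun _ _ => by lia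
  ext i
  · simp [h, HahnSeries.coeff_single_mul]
  · rw [coeff_doubleExpansion_snd, h, HahnSeries.coeff_single_mul, coeff_doubleExpansion_snd]
    congr 2
    ring

/-- The map to the module coinduced from the trivial representation of a subgroup on which the
exponent vanishes; it reads off the coefficients of the difference of two expansions. -/
def toCoind {S : Subgroup G} (hS : S ≤ χ.ker) :
    (doubleLaurentRep k χ).IntertwiningMap
      (Representation.coind S.subtype (Representation.trivial k S k)) where
  toLinearMap :=
    { toFun x := ⟨fun g => (doubleLaurentRep k χ g x).1.coeff 0 -
          (doubleLaurentRep k χ g x).2.coeff 0, fun s g => by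
        have hs : χ s = 1 := hS s.2
        simp [doubleLaurentRep_apply, hs, signedMonomial_zero]⟩
      map_add' x y := by
        ext g
        simp only [map_add, Prod.fst_add, Prod.snd_add, HahnSeries.coeff_add]
        exact add_sub_add_comm _ _ _ _
      map_smul' c x := by
        ext g
        simp only [map_smul, Prod.smul_fst, Prod.smul_snd, HahnSeries.coeff_smul]
        exact (smul_sub _ _ _).symm }
  isIntertwining' g := by
    refine LinearMap.ext fun x => Subtype.ext (funext fun h => ?_)
    change (doubleLaurentRep k χ h (doubleLaurentRep k χ g x)).1.coeff 0 -
        (doubleLaurentRep k χ h (doubleLaurentRep k χ g x)).2.coeff 0 =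
      (doubleLaurentRep k χ (h * g) x).1.coeff 0 - (doubleLaurentRep k χ (h * g) x).2.coeff 0
    rw [map_mul, Module.End.mul_apply]

theorem toCoind_apply {S : Subgroup G} (hS : S ≤ χ.ker) (x : k⸨X⸩ × k⸨X⸩) (g : G) :
    (toCoind χ hS x).1 g = (-1) ^ (χ g).toAdd *
      (x.1.coeff (-(χ g).toAdd) - x.2.coeff (χ g).toAdd) := by
  change (doubleLaurentRep k χ g x).1.coeff 0 - (doubleLaurentRep k χ g x).2.coeff 0 = _
  simp [doubleLaurentRep_apply, coeff_signedMonomial_mul, mul_sub]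

theorem toCoind_eq_zero_iff (hχ : Function.Surjective χ) {S : Subgroup G} (hS : S ≤ χ.ker)
    (x : k⸨X⸩ × k⸨X⸩) : toCoind χ hS x = 0 ↔ ∀ i, x.1.coeff i = x.2.coeff (-i) := by
  have h0 (m : ℤ) : ((-1 : k) ^ m) ≠ 0 := zpow_ne_zero _ (by simp)
  constructor
  · intro h i
    obtain ⟨g, hg⟩ := hχ (.ofAdd (-i))
    have := congrArg (fun f => f.1 g) h
    simp only [toCoind_apply, hg] at this
    simpa [h0, sub_eq_zero] using this
  · intro h
    ext g
    rw [toCoind_apply, h, neg_neg, sub_self, mul_zero]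
    rfl

theorem toCoind_surjective (hχ : Function.Surjective χ) {S : Subgroup G} (hS : S = χ.ker) :
    Function.Surjective (toCoind (k := k) χ hS.le) := by
  intro f
  choose s hs using fun i : ℤ => hχ (.ofAdd i)
  have hf (g : G) : f.1 g = f.1 (s (χ g).toAdd) := by
    have hmem : g * (s (χ g).toAdd)⁻¹ ∈ S := by
      rw [hS, MonoidHom.mem_ker, map_mul, map_inv, hs, ofAdd_toAdd, mul_inv_cancel]
    simpa using f.2 ⟨_, hmem⟩ (s (χ g).toAdd)
  have h1 : BddBelow (Function.support fun i : ℤ => if 0 ≤ i then (-1) ^ i * f.1 (s (-i)) else 0) :=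
    ⟨0, fun i hi => by by_contra h; simp [h] at hi⟩
  have h2 : BddBelow (Function.support fun i : ℤ => if 0 < i then -((-1) ^ i * f.1 (s i)) else 0) :=
    ⟨0, fun i hi => by by_contra h; simp [not_lt.2 (not_le.1 h).le] at hi⟩
  refine ⟨(HahnSeries.ofSuppBddBelow _ h1, HahnSeries.ofSuppBddBelow _ h2), ?_⟩
  ext g
  have hsq (m : ℤ) : ((-1 : k) ^ m) * (-1) ^ m = 1 := by
    rw [← mul_zpow]; simp
  rw [toCoind_apply, hf g]
  generalize (χ g).toAdd = m
  simp only [HahnSeries.coeff_ofSuppBddBelow]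
  rcases le_or_gt m 0 with h | h
  · rw [if_pos (by lia), if_neg (by lia), sub_zero, ← mul_assoc, neg_neg, zpow_neg, ← inv_zpow,
      inv_neg_one, hsq, one_mul]
  · rw [if_neg (by lia), if_pos (by lia), zero_sub, neg_neg, ← mul_assoc, hsq, one_mul]

theorem nonempty_groupCohomology_laurent_equiv {k G : Type u} [Field k] [Group G]
    (χ : G →* Multiplicative ℤ) (hχ : Function.Surjective χ) {S : Subgroup G} (hS : S = χ.ker)
    {z : G} (hz : ∀ g, Commute z g) (hχz : (χ z).toAdd ≠ 0) (ρ : Representation k G k[T;T⁻¹])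
    (hρ : ∀ g p, ρ g p =
      LaurentPolynomial.C ((-1) ^ (χ g).toAdd) * LaurentPolynomial.T (χ g).toAdd * p) (j : ℕ) :
    Nonempty (groupCohomology (Rep.of ρ) (j + 1) ≃ₗ[k]
      groupCohomology (Rep.trivial k S k) j) := by
  let f : Rep.of ρ ⟶ Rep.of (doubleLaurentRep k χ) := Rep.ofHom
    ⟨doubleExpansion k, fun g => LinearMap.ext fun p =>
      (congrArg _ (hρ g p)).trans (doubleExpansion_mul _ _ p)⟩
  let r : Rep.of (doubleLaurentRep k χ) ⟶ Rep.coind S.subtype (Rep.trivial k S k) :=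
    Rep.ofHom (toCoind χ hS.le)
  have hfr : f ≫ r = 0 := by
    refine Rep.hom_ext (Representation.IntertwiningMap.ext (LinearMap.ext fun p => ?_))
    exact (toCoind_eq_zero_iff χ hχ hS.le (doubleExpansion k p)).2 fun i => by simp
  let X : ShortComplex (Rep.{u} k G) := .mk f r hfr
  have hX : X.ShortExact :=
    { exact := by
        rw [← ShortComplex.exact_map_iff_of_faithful X (forget₂ (Rep.{u} k G) (ModuleCat.{u} k)),
          ShortComplex.moduleCat_exact_iff]
        exact fun x hx => exists_doubleExpansion_eq ((toCoind_eq_zero_iff χ hχ hS.le x).1 hx)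
      mono_f := (Rep.mono_iff_injective f).2 doubleExpansion_injective
      epi_g := (Rep.epi_iff_surjective r).2 (toCoind_surjective χ hχ hS) }
  have hzero (i : ℕ) : IsZero (groupCohomology X.X₂ i) :=
    isZero_groupCohomology_of_central _ z hz (bijective_doubleLaurentRep_sub χ hχz) i
  have := groupCohomology.isIso_δ_of_isZero hX j (hzero j) (hzero (j + 1))
  exact ⟨((asIso (groupCohomology.δ hX j (j + 1) rfl)).symm ≪≫
    groupCohomology.coindIso (Rep.trivial k S k) j).toLinearEquiv⟩

end

section
variable {G : Type*} [Group G] (s : ℕ → G)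

/-- The pure braid `s_k ⋯ s_1 s_0² s_1 ⋯ s_k`, where the `k`-th strand encircles all previous ones. -/
def jucysMurphyBraid : ℕ → G
  | 0 => s 0 * s 0
  | k + 1 => s (k + 1) * jucysMurphyBraid k * s (k + 1)

/-- The product of the first `k` Jucys–Murphy braids, i.e. the full twist on `k + 1` strands. -/
def fullTwist : ℕ → G
  | 0 => 1
  | k + 1 => fullTwist k * jucysMurphyBraid s k

variable {s} {N : ℕ}

theorem jucysMurphyBraid_commute_of_far
    (hcomm : ∀ i j, i + 2 ≤ j → j < N → Commute (s i) (s j))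
    {k j : ℕ} (hkj : k + 2 ≤ j) (hj : j < N) : Commute (jucysMurphyBraid s k) (s j) := by
  induction k with
  | zero => exact (hcomm 0 j hkj hj).mul_left (hcomm 0 j hkj hj)
  | succ k ih =>
    exact ((hcomm _ _ hkj hj).mul_left (ih (by lia))).mul_left (hcomm _ _ hkj hj)

theorem fullTwist_commute_of_far
    (hcomm : ∀ i j, i + 2 ≤ j → j < N → Commute (s i) (s j))
    {k j : ℕ} (hkj : k + 1 ≤ j) (hj : j < N) : Commute (fullTwist s k) (s j) := by
  induction k with
  | zero => exact Commute.one_left _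
  | succ k ih =>
    exact (ih (by lia)).mul_left (jucysMurphyBraid_commute_of_far hcomm hkj hj)

theorem jucysMurphyBraid_commute
    (hcomm : ∀ i j, i + 2 ≤ j → j < N → Commute (s i) (s j))
    (hbraid : ∀ i, i + 1 < N → s i * s (i + 1) * s i = s (i + 1) * s i * s (i + 1))
    {k i : ℕ} (hik : i < k) (hk : k < N) : Commute (jucysMurphyBraid s k) (s i) := by
  induction k generalizing i with
  | zero => lia
  | succ k ih =>
    rcases Nat.lt_succ_iff_lt_or_eq.1 hik with h | rfl
    · have h1 := (hcomm i (k + 1) (by lia) hk).symm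
      exact (h1.mul_left (ih h (by lia))).mul_left h1
    · have hb := hbraid i hk
      rcases i with _ | i
      · change s 1 * (s 0 * s 0) * s 1 * s 0 = s 0 * (s 1 * (s 0 * s 0) * s 1)
        simp only [zero_add] at hb
        calc s 1 * (s 0 * s 0) * s 1 * s 0 = s 1 * s 0 * (s 0 * s 1 * s 0) := by group
          _ = (s 1 * s 0 * s 1) * s 0 * s 1 := by rw [hb]; group
          _ = _ := by rw [← hb]; group
      · have hJ : Commute (jucysMurphyBraid s i) (s (i + 2)) :=
          jucysMurphyBraid_commute_of_far hcomm le_rfl hk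
        change s (i + 2) * (s (i + 1) * jucysMurphyBraid s i * s (i + 1)) * s (i + 2) * s (i + 1) =
          s (i + 1) * (s (i + 2) * (s (i + 1) * jucysMurphyBraid s i * s (i + 1)) * s (i + 2))
        change s (i + 1) * s (i + 2) * s (i + 1) = s (i + 2) * s (i + 1) * s (i + 2) at hb
        calc s (i + 2) * (s (i + 1) * jucysMurphyBraid s i * s (i + 1)) * s (i + 2) * s (i + 1)
            = s (i + 2) * s (i + 1) * jucysMurphyBraid s i *
                (s (i + 1) * s (i + 2) * s (i + 1)) := by group
          _ = s (i + 2) * s (i + 1) * (jucysMurphyBraid s i * s (i + 2)) * s (i + 1) * s (i + 2) :=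
            by rw [hb]; group
          _ = (s (i + 2) * s (i + 1) * s (i + 2)) * jucysMurphyBraid s i * s (i + 1) * s (i + 2) :=
            by rw [hJ.eq]; group
          _ = _ := by rw [← hb]; group

theorem jucysMurphyBraid_commute_jucysMurphyBraid
    (hcomm : ∀ i j, i + 2 ≤ j → j < N → Commute (s i) (s j))
    (hbraid : ∀ i, i + 1 < N → s i * s (i + 1) * s i = s (i + 1) * s i * s (i + 1))
    {k i : ℕ} (hik : i < k) (hk : k < N) :
    Commute (jucysMurphyBraid s k) (jucysMurphyBraid s i) := by
  induction i with
  | zero =>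
    have h := jucysMurphyBraid_commute hcomm hbraid hik hk
    exact h.mul_right h
  | succ i ih =>
    have h := jucysMurphyBraid_commute hcomm hbraid hik hk
    exact (h.mul_right (ih (by lia))).mul_right h

theorem fullTwist_commute
    (hcomm : ∀ i j, i + 2 ≤ j → j < N → Commute (s i) (s j))
    (hbraid : ∀ i, i + 1 < N → s i * s (i + 1) * s i = s (i + 1) * s i * s (i + 1))
    {k i : ℕ} (hik : i < k) (hk : k ≤ N) : Commute (fullTwist s k) (s i) := by
  induction k generalizing i with
  | zero => lia
  | succ k ih =>
    rcases Nat.lt_succ_iff_lt_or_eq.1 hik with h | rfl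
    · exact (ih h (by lia)).mul_left (jucysMurphyBraid_commute hcomm hbraid h (by lia))
    · rcases i with _ | i
      · change Commute (1 * (s 0 * s 0)) (s 0)
        rw [one_mul]
        exact (Commute.refl _).mul_left (Commute.refl _)
      · have hF : Commute (fullTwist s i) (s (i + 1)) :=
          fullTwist_commute_of_far hcomm le_rfl hk
        have hJ : s (i + 1) * jucysMurphyBraid s i * s (i + 1) * jucysMurphyBraid s i =
            jucysMurphyBraid s i * (s (i + 1) * jucysMurphyBraid s i * s (i + 1)) :=
          jucysMurphyBraid_commute_jucysMurphyBraid hcomm hbraid (Nat.lt_succ_self i) hk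
        change fullTwist s i * jucysMurphyBraid s i *
          (s (i + 1) * jucysMurphyBraid s i * s (i + 1)) * s (i + 1) = s (i + 1) *
            (fullTwist s i * jucysMurphyBraid s i * (s (i + 1) * jucysMurphyBraid s i * s (i + 1)))
        calc _ = fullTwist s i * (jucysMurphyBraid s i *
              (s (i + 1) * jucysMurphyBraid s i * s (i + 1))) * s (i + 1) := by group
          _ = (fullTwist s i * s (i + 1)) * (jucysMurphyBraid s i *
              (s (i + 1) * jucysMurphyBraid s i * s (i + 1))) := by nth_rw 1 [← hJ]; group
          _ = _ := by rw [hF.eq]; group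

theorem map_jucysMurphyBraid (χ : G →* Multiplicative ℤ)
    (hs : ∀ i < N, χ (s i) = .ofAdd 1) {k : ℕ} (hk : k < N) :
    (χ (jucysMurphyBraid s k)).toAdd = 2 * (k + 1) := by
  induction k with
  | zero => simp [jucysMurphyBraid, hs 0 hk]
  | succ k ih => simp [jucysMurphyBraid, hs _ hk, ih (by lia)]; ring

theorem map_fullTwist (χ : G →* Multiplicative ℤ)
    (hs : ∀ i < N, χ (s i) = .ofAdd 1) {k : ℕ} (hk : k ≤ N) :
    (χ (fullTwist s k)).toAdd = k * (k + 1) := by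
  induction k with
  | zero => simp [fullTwist]
  | succ k ih => simp [fullTwist, map_jucysMurphyBraid χ hs hk, ih (by lia)]; ring
end

theorem lift_braidWord {B H : Type*} [Group H] (f : B → H) (s t : B) (m : ℕ) :
    FreeGroup.lift f (braidWord s t m) =
      ((List.range m).map (fun i => if i % 2 = 0 then f s else f t)).prod := by
  rw [braidWord, map_list_prod, List.map_map]
  congr 2
  ext i
  simp only [Function.comp_apply]
  split_ifs <;> simp

/-- The exponent sum homomorphism of a braid group. -/
def braidExponent (n : ℕ) : BraidGroup n →* Multiplicative ℤ :=
  PresentedGroup.toGroup (f := fun _ => Multiplicative.ofAdd 1) (rels := artinRels _) <| by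
    rintro _ ⟨s, t, -, -, rfl⟩
    simp [lift_braidWord]

@[simp]
theorem braidExponent_braidGen (n : ℕ) (i : Fin (n - 1)) :
    braidExponent n (braidGen n i) = Multiplicative.ofAdd 1 :=
  PresentedGroup.toGroup.of _

theorem BraidGroup.hom_ext {n : ℕ} {H : Type*} [Group H] {f g : BraidGroup n →* H}
    (h : ∀ i, f (braidGen n i) = g (braidGen n i)) : f = g :=
  PresentedGroup.ext (rels := artinRels _) h

theorem BraidGroup.artin_relation {n : ℕ} {i j : Fin (n - 1)} (hij : i ≠ j) (m : ℕ) (hm : m ≠ 0)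
    (hM : CoxeterMatrix.A (n - 1) i j = m) :
    ((List.range m).map (fun l => if l % 2 = 0 then braidGen n i else braidGen n j)).prod =
      ((List.range m).map (fun l => if l % 2 = 0 then braidGen n j else braidGen n i)).prod := by
  have h := PresentedGroup.one_of_mem (rels := artinRels (CoxeterMatrix.A (n - 1)))
    ⟨i, j, hij, hM ▸ hm, rfl⟩
  rw [map_mul, map_inv, mul_inv_eq_one, hM] at h
  have hmk : PresentedGroup.mk (artinRels (CoxeterMatrix.A (n - 1))) =
      FreeGroup.lift (PresentedGroup.of) := by ext; simp; rfl
  rw [hmk, lift_braidWord, lift_braidWord] at h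
  exact h

theorem BraidGroup.commute_braidGen {n : ℕ} {i j : Fin (n - 1)} (hij : (i : ℕ) + 2 ≤ j) :
    Commute (braidGen n i) (braidGen n j) := by
  have hne : i ≠ j := by rintro rfl; lia
  have h := BraidGroup.artin_relation hne 2 two_ne_zero (by
    simp only [CoxeterMatrix.A, Matrix.of_apply]
    rw [if_neg hne, if_neg (by lia)])
  simpa [List.range_succ, commute_iff_eq] using h

theorem BraidGroup.braid_relation {n : ℕ} {i j : Fin (n - 1)} (hij : (i : ℕ) + 1 = j) :
    braidGen n i * braidGen n j * braidGen n i = braidGen n j * braidGen n i * braidGen n j := by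
  have hne : i ≠ j := by rintro rfl; lia
  have h := BraidGroup.artin_relation hne 3 three_ne_zero (by
    simp only [CoxeterMatrix.A, Matrix.of_apply]
    rw [if_neg hne, if_pos (by lia)])
  simpa [List.range_succ, mul_assoc] using h

theorem Abelianization.of_braidGen_eq {n : ℕ} (i j : Fin (n - 1)) :
    Abelianization.of (braidGen n i) = Abelianization.of (braidGen n j) := by
  suffices h : ∀ (m : ℕ) (hm : m < n - 1), Abelianization.of (braidGen n ⟨m, hm⟩) =
      Abelianization.of (braidGen n ⟨0, by lia⟩) from (h i i.2).trans (h j j.2).symm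
  intro m hm
  induction m with
  | zero => rfl
  | succ m ih =>
    rw [← ih (by lia)]
    have h := congrArg Abelianization.of
      (BraidGroup.braid_relation (i := ⟨m, by lia⟩) (j := ⟨m + 1, hm⟩) rfl)
    simp only [map_mul] at h
    rw [mul_comm (Abelianization.of (braidGen n ⟨m + 1, hm⟩))] at h
    exact (mul_left_cancel h).symm

theorem ker_braidExponent {n : ℕ} (hn : 2 ≤ n) :
    (braidExponent n).ker = commutator (BraidGroup n) := by
  refine le_antisymm (fun g hg => ?_) (Abelianization.commutator_subset_ker _)
  have h : (Abelianization.of : BraidGroup n →* _) =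
      (zpowersHom _ (Abelianization.of (braidGen n ⟨0, by lia⟩))).comp (braidExponent n) :=
    BraidGroup.hom_ext fun i => by
      simpa [zpowersHom_apply] using Abelianization.of_braidGen_eq i _
  rw [← Abelianization.ker_of, MonoidHom.mem_ker, h, MonoidHom.comp_apply, MonoidHom.mem_ker.1 hg,
    map_one]

theorem BraidGroup.commute_of_commute_braidGen {n : ℕ} {z : BraidGroup n}
    (hz : ∀ i, Commute z (braidGen n i)) (g : BraidGroup n) : Commute z g := by
  have h : (MulAut.conj z).toMonoidHom = MonoidHom.id (BraidGroup n) :=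
    BraidGroup.hom_ext fun i => by simp [(hz i).eq]
  have hg := DFunLike.congr_fun h g
  exact mul_inv_eq_iff_eq_mul.1 hg

theorem braidExponent_surjective {n : ℕ} (hn : 2 ≤ n) : Function.Surjective (braidExponent n) :=
  fun m => ⟨braidGen n ⟨0, by lia⟩ ^ m.toAdd, by simp [← ofAdd_zsmul]⟩

theorem BraidGroup.exists_central_exponent_ne_zero {n : ℕ} (hn : 2 ≤ n) :
    ∃ z : BraidGroup n, (∀ g, Commute z g) ∧ (braidExponent n z).toAdd ≠ 0 := by
  let s (i : ℕ) : BraidGroup n := if h : i < n - 1 then braidGen n ⟨i, h⟩ else 1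
  have hs {i : ℕ} (h : i < n - 1) : s i = braidGen n ⟨i, h⟩ := dif_pos h
  refine ⟨fullTwist s (n - 1), BraidGroup.commute_of_commute_braidGen fun i => ?_, ?_⟩
  · rw [← hs i.2]
    refine fullTwist_commute (N := n - 1) (fun a b hab hb => ?_) (fun a ha => ?_) i.2 le_rfl
    · rw [hs hb, hs (by lia)]
      exact BraidGroup.commute_braidGen hab
    · rw [hs ha, hs (by lia)]
      exact BraidGroup.braid_relation rfl
  · rw [map_fullTwist (N := n - 1) _ (fun i hi => by rw [hs hi, braidExponent_braidGen]) le_rfl]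
    have : 0 < n - 1 := by lia
    positivity

theorem BraidGroup.rep_apply {n : ℕ} {k : Type*} [Field k]
    (ρ : Representation k (BraidGroup n) k[T;T⁻¹])
    (hρ : ∀ s x, ρ (braidGen n s) x = -(LaurentPolynomial.T 1) * x)
    (g : BraidGroup n) (x : k[T;T⁻¹]) :
    ρ g x = LaurentPolynomial.C ((-1) ^ (braidExponent n g).toAdd) *
      LaurentPolynomial.T (braidExponent n g).toAdd * x := by
  let ψ : Representation k (BraidGroup n) k[T;T⁻¹] :=
    { toFun g := LinearMap.mulLeft k (LaurentPolynomial.C ((-1) ^ (braidExponent n g).toAdd) *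
        LaurentPolynomial.T (braidExponent n g).toAdd)
      map_one' := by
        ext
        simp
      map_mul' g h := by
        refine LinearMap.ext fun p => ?_
        simp only [map_mul, toAdd_mul, LaurentPolynomial.T_add, Module.End.mul_apply,
          LinearMap.mulLeft_apply, zpow_add₀ (neg_ne_zero.2 (one_ne_zero (α := k)))]
        ring }
  have h : ρ.toHomUnits = ψ.toHomUnits := BraidGroup.hom_ext fun i =>
    Units.ext (LinearMap.ext fun p => (hρ i p).trans (by simp [ψ]))
  exact LinearMap.congr_fun (congrArg Units.val (DFunLike.congr_fun h g)) x

theorem braid_cohomology_milnor_fiber_shift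
    (n : ℕ) (hn : 2 ≤ n) (j : ℕ)
    (ρ : Representation ℚ (BraidGroup n) (LaurentPolynomial ℚ))
    (hρ : ∀ (s : Fin (n - 1)) (x : LaurentPolynomial ℚ),
      (ρ (braidGen n s)) x = -(LaurentPolynomial.T 1) * x) :
    Nonempty ((groupCohomology (Rep.of ρ) (j + 1)) ≃ₗ[ℚ]
      (groupCohomology (Rep.trivial ℚ (↥(commutator (BraidGroup n))) ℚ) j)) := by
  obtain ⟨z, hz, hχz⟩ := BraidGroup.exists_central_exponent_ne_zero hn
  exact nonempty_groupCohomology_laurent_equiv (braidExponent n) (braidExponent_surjective hn)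
    (ker_braidExponent hn).symm hz hχz ρ (BraidGroup.rep_apply ρ hρ) j
end

section
/- Let B_3 be the braid group on three strands, B_3' = [B_3, B_3] its commutator subgroup, and let ℤ[q^{±1}] carry the B_3-action in which each standard generator σ_i acts by multiplication by −q. Then for every j ≥ 0 there is an isomorphism of abelian groups H^{j+1}(B_3; ℤ[q^{±1}]) ≅ H^j(B_3'; ℤ), where ℤ carries the trivial B_3'-action. -/
section CentralElements

open CategoryTheory

namespace Rep

variable {k G : Type} [CommRing k] [Group G]

/-- The endomorphism of a representation given by the action of a central element. -/
noncomputable def centralEnd (A : Rep.{0} k G) (z : Subgroup.center G) : A ⟶ A :=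
  Rep.ofHom ⟨A.ρ z, fun g ↦ by
    rw [← Module.End.mul_eq_comp, ← Module.End.mul_eq_comp, ← map_mul, ← map_mul,
      Subgroup.mem_center_iff.1 z.2 g]⟩

lemma centralEnd_comm {A B : Rep.{0} k G} (f : A ⟶ B) (z : Subgroup.center G) :
    A.centralEnd z ≫ f = f ≫ B.centralEnd z := by
  ext x
  exact hom_comm_apply f z x

lemma centralEnd_trivial (z : Subgroup.center G) :
    (Rep.trivial k G k).centralEnd z = 𝟙 _ := by
  ext; simp [centralEnd]

/-- The chain endomorphism given by the action of a central element. -/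
noncomputable def centralChainEnd (P : ChainComplex (Rep.{0} k G) ℕ) (z : Subgroup.center G) :
    P ⟶ P where
  f i := (P.X i).centralEnd z
  comm' _ _ _ := centralEnd_comm _ z

/-- A central element acts on a projective resolution of the trivial representation by
a chain map homotopic to the identity. -/
noncomputable def centralChainEndHomotopy
    (P : ProjectiveResolution (Rep.trivial k G k)) (z : Subgroup.center G) :
    Homotopy (centralChainEnd P.complex z) (𝟙 P.complex) :=
  ProjectiveResolution.liftHomotopy (𝟙 _) _ _
    (by
      ext1
      simp only [HomologicalComplex.comp_f, CategoryTheory.Functor.map_id, Category.comp_id]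
      refine (centralEnd_comm (P.π.f 0) z).trans ?_
      erw [centralEnd_trivial, Category.comp_id])
    (by simp)

lemma exact_of_forall_exists {X : ShortComplex (Rep.{0} k G)}
    (h : ∀ x : X.X₂, X.g.hom x = 0 → ∃ y : X.X₁, X.f.hom y = x) : X.Exact := by
  rw [← ShortComplex.exact_map_iff_of_faithful X (forget₂ (Rep.{0} k G) (ModuleCat.{0} k)),
    ShortComplex.moduleCat_exact_iff]
  exact h

end Rep

namespace groupCohomology

variable {k G : Type} [CommRing k] [Group G]

/-- If `z - 1` is invertible on `A` for some central element `z`, then the cohomology with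
coefficients in `A` vanishes. -/
theorem isZero_of_central_sub_one_bijective (A : Rep.{0} k G) (z : Subgroup.center G)
    (hz : Function.Bijective fun x : A ↦ A.ρ z x - x) (n : ℕ) :
    Limits.IsZero (groupCohomology A n) := by
  let P := Rep.barResolution k G
  refine Limits.IsZero.of_iso ?_ (groupCohomologyIso A n P)
  have hiso : IsIso (A.centralEnd z - 𝟙 A) := by
    have : IsIso ((forget (Rep k G)).map (A.centralEnd z - 𝟙 A)) :=
      (isIso_iff_bijective _).2 hz
    exact isIso_of_reflects_iso _ (forget (Rep k G))
  rw [← HomologicalComplex.exactAt_iff_isZero_homology, HomologicalComplex.exactAt_iff,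
    ShortComplex.moduleCat_exact_iff]
  intro (f : P.complex.X n ⟶ A) hf
  replace hf : P.complex.d ((ComplexShape.up ℕ).next n) n ≫ f = 0 := hf
  let H := Rep.centralChainEndHomotopy P z
  let g : P.complex.X n ⟶ A := f ≫ inv (A.centralEnd z - 𝟙 A)
  have hg : P.complex.d ((ComplexShape.up ℕ).next n) n ≫ g = 0 := by
    rw [← Category.assoc, hf, Limits.zero_comp]
  have hprev : prevD n H.hom ≫ g = 0 := by
    refine (Category.assoc _ _ _).trans ?_
    exact (congrArg _ hg).trans Limits.comp_zero
  have hcomm : (P.complex.X n).centralEnd z = dNext n H.hom + prevD n H.hom + 𝟙 _ := H.comm n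
  refine ⟨H.hom ((ComplexShape.up ℕ).prev n) n ≫ g, ?_⟩
  change P.complex.d n ((ComplexShape.up ℕ).prev n) ≫
    H.hom ((ComplexShape.up ℕ).prev n) n ≫ g = f
  have hd : P.complex.d n ((ComplexShape.up ℕ).prev n) ≫
      H.hom ((ComplexShape.up ℕ).prev n) n ≫ g = dNext n H.hom ≫ g :=
    (Category.assoc _ _ _).symm
  calc _ = (dNext n H.hom + prevD n H.hom) ≫ g := by
        rw [hd, Preadditive.add_comp, hprev, add_zero]
    _ = ((P.complex.X n).centralEnd z - 𝟙 _) ≫ g := by rw [hcomm, add_sub_cancel_right]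
    _ = g ≫ (A.centralEnd z - 𝟙 A) := by
        rw [Preadditive.sub_comp, Rep.centralEnd_comm, Preadditive.comp_sub, Category.id_comp,
          Category.comp_id]
    _ = f := by rw [Category.assoc, IsIso.inv_hom_id, Category.comp_id]

end groupCohomology

end CentralElements

/-- Pairs of bi-infinite integer sequences, the first vanishing far to the left and the second
vanishing far to the right. -/
def halfBoundedPairs : Submodule ℤ ((ℤ → ℤ) × (ℤ → ℤ)) where
  carrier := {p | (∃ N, ∀ m < N, p.1 m = 0) ∧ ∃ N, ∀ m > N, p.2 m = 0}
  zero_mem' := ⟨⟨0, fun _ _ ↦ rfl⟩, ⟨0, fun _ _ ↦ rfl⟩⟩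
  add_mem' := by
    rintro p q ⟨⟨a, ha⟩, ⟨b, hb⟩⟩ ⟨⟨c, hc⟩, ⟨d, hd⟩⟩
    refine ⟨⟨min a c, fun m hm ↦ ?_⟩, ⟨max b d, fun m hm ↦ ?_⟩⟩
    · simp [ha m (by omega), hc m (by omega)]
    · simp [hb m (by omega), hd m (by omega)]
  smul_mem' := by
    rintro r p ⟨⟨a, ha⟩, ⟨b, hb⟩⟩
    refine ⟨⟨a, fun m hm ↦ ?_⟩, ⟨b, fun m hm ↦ ?_⟩⟩
    · simp [ha m hm]
    · simp [hb m hm]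

/-- Translation of the index by `c` on pairs of half-bounded sequences. -/
def halfBoundedShift (c : ℤ) : halfBoundedPairs →ₗ[ℤ] halfBoundedPairs :=
  ((LinearMap.funLeft ℤ ℤ (· + c)).prodMap (LinearMap.funLeft ℤ ℤ (· + c))).restrict <| by
    rintro p ⟨⟨a, ha⟩, ⟨b, hb⟩⟩
    exact ⟨⟨a - c, fun m hm ↦ ha (m + c) (by omega)⟩,
      ⟨b - c, fun m hm ↦ hb (m + c) (by omega)⟩⟩

lemma halfBoundedShift_fst (c : ℤ) (p : halfBoundedPairs) (m : ℤ) :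
    (halfBoundedShift c p).1.1 m = p.1.1 (m + c) := rfl

lemma halfBoundedShift_snd (c : ℤ) (p : halfBoundedPairs) (m : ℤ) :
    (halfBoundedShift c p).1.2 m = p.1.2 (m + c) := rfl

lemma halfBoundedPairs_ext {p q : halfBoundedPairs} (h₁ : ∀ m, p.1.1 m = q.1.1 m)
    (h₂ : ∀ m, p.1.2 m = q.1.2 m) : p = q :=
  Subtype.ext (Prod.ext (funext h₁) (funext h₂))

/-- A sequence vanishing far to the left and invariant under a positive translation is zero. -/
lemma eq_zero_of_periodic_of_bounded {f : ℤ → ℤ} {c : ℤ} (hc : 0 < c)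
    (hf : ∀ m, f (m + c) = f m) (hN : ∃ N, ∀ m < N, f m = 0) (m : ℤ) : f m = 0 := by
  obtain ⟨N, hN⟩ := hN
  have h : ∀ i : ℕ, f (m - i * c) = f m := fun i ↦ by
    induction i with
    | zero => simp
    | succ i ih =>
      rw [← ih, ← hf (m - (i + 1 : ℕ) * c)]
      congr 1
      push_cast
      ring
  rw [← h (m - N + 1).toNat]
  refine hN _ ?_
  have := Int.self_le_toNat (m - N + 1)
  nlinarith [Int.natCast_nonneg (m - N + 1).toNat]

/-- The difference equation `f (m + c) - f m = h m` is solvable among sequences vanishing far to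
the left. -/
lemma exists_bounded_sub_eq {h : ℤ → ℤ} {c : ℤ} (hc : 0 < c) (hN : ∃ N, ∀ m < N, h m = 0) :
    ∃ f : ℤ → ℤ, (∃ N, ∀ m < N, f m = 0) ∧ ∀ m, f (m + c) - f m = h m := by
  obtain ⟨N, hN⟩ := hN
  have hvanish : ∀ (m : ℤ) (i : ℕ), (m - N).toNat ≤ i → h (m - (i + 1) * c) = 0 := by
    intro m i hi
    refine hN _ ?_
    have := Int.self_le_toNat (m - N)
    have hi' : ((m - N).toNat : ℤ) ≤ i := by exact_mod_cast hi
    nlinarith [Int.natCast_nonneg i]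
  have hsum : ∀ (m : ℤ) (L : ℕ), (m - N).toNat ≤ L →
      ∑ i ∈ Finset.range (m - N).toNat, h (m - (i + 1) * c) =
        ∑ i ∈ Finset.range L, h (m - (i + 1) * c) := fun m L hL ↦
    Finset.sum_subset (Finset.range_mono hL) fun i _ hi ↦
      hvanish m i (by simpa using hi)
  refine ⟨fun m ↦ ∑ i ∈ Finset.range (m - N).toNat, h (m - (i + 1) * c),
    ⟨N, fun m hm ↦ ?_⟩, fun m ↦ ?_⟩
  · have : (m - N).toNat = 0 := by omega
    simp [this]
  · have hL := hsum (m + c) ((m + c - N).toNat + (m - N).toNat + 1) (by omega)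
    have hR := hsum m ((m + c - N).toNat + (m - N).toNat) (by omega)
    simp only [hL, hR, Finset.sum_range_succ']
    have : ∀ i : ℕ, m + c - ((i + 1 : ℕ) + 1) * c = m - (i + 1) * c := fun i ↦ by
      push_cast; ring
    simp only [this]
    simp

lemma halfBoundedShift_sub_bijective {c : ℤ} (hc : 0 < c) :
    Function.Bijective fun p : halfBoundedPairs ↦ halfBoundedShift c p - p := by
  constructor
  · intro p q hpq
    have hd : halfBoundedShift c (p - q) = p - q := by
      rw [map_sub]
      simp only at hpq
      rw [sub_eq_sub_iff_sub_eq_sub] at hpq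
      exact hpq
    rw [← sub_eq_zero]
    refine halfBoundedPairs_ext (fun m ↦ ?_) (fun m ↦ ?_)
    · refine eq_zero_of_periodic_of_bounded hc (fun m ↦ ?_) (p - q).2.1 m
      rw [← halfBoundedShift_fst, hd]
    · obtain ⟨N, hN⟩ := (p - q).2.2
      have := eq_zero_of_periodic_of_bounded (f := fun m ↦ (p - q).1.2 (-m)) hc (fun m ↦ ?_)
        ⟨-N, fun m hm ↦ hN _ (by omega)⟩ (-m)
      · simpa using this
      · rw [show -m = -(m + c) + c by ring, ← halfBoundedShift_snd, hd]
  · intro ⟨⟨a, b⟩, ha, N, hN⟩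
    obtain ⟨f, hf, hfa⟩ := exists_bounded_sub_eq hc ha
    obtain ⟨g, ⟨K, hg⟩, hgb⟩ := exists_bounded_sub_eq (h := fun m ↦ -b (-m - c)) hc
      ⟨-N - c, fun m hm ↦ by simpa using hN _ (by omega)⟩
    refine ⟨⟨(f, fun m ↦ g (-m)), hf, -K, fun m hm ↦ hg _ (by omega)⟩, ?_⟩
    refine halfBoundedPairs_ext (fun m ↦ hfa m) (fun m ↦ ?_)
    have := hgb (-m - c)
    change g (-(m + c)) - g (-m) = b m
    ring_nf at this ⊢
    linarith

section Shift

variable {G : Type} [Group G] (φ : G →* Multiplicative ℤ)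

/-- The representation on pairs of half-bounded sequences by translation through `φ`. -/
def halfBoundedRep : Representation ℤ G halfBoundedPairs where
  toFun g := halfBoundedShift (φ g).toAdd
  map_one' := by
    ext1 p
    refine halfBoundedPairs_ext (fun m ↦ ?_) (fun m ↦ ?_)
    · simp [halfBoundedShift_fst]
    · simp [halfBoundedShift_snd]
  map_mul' g h := by
    ext1 p
    refine halfBoundedPairs_ext (fun m ↦ ?_) (fun m ↦ ?_)
    · simp [halfBoundedShift_fst, add_assoc]
    · simp [halfBoundedShift_snd, add_assoc]

/-- The map sending a pair of half-bounded sequences to their sum, viewed as a function on `G`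
through `φ`. -/
def halfBoundedToCoind (N : Subgroup G) (hN : N ≤ φ.ker) :
    (halfBoundedRep φ).IntertwiningMap
      (Representation.coind N.subtype (Representation.trivial ℤ N ℤ)) where
  toFun p := ⟨fun g ↦ p.1.1 (φ g).toAdd + p.1.2 (φ g).toAdd, fun n g ↦ by
    have : φ n = 1 := hN n.2
    simp [this]⟩
  map_add' p q := by
    ext g
    exact add_add_add_comm (p.1.1 _) (q.1.1 _) (p.1.2 _) (q.1.2 _)
  map_smul' r p := by
    ext g
    exact (mul_add _ _ _).symm
  isIntertwining' g := by
    ext p x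
    change p.1.1 _ + p.1.2 _ = p.1.1 _ + p.1.2 _
    rw [map_mul, toAdd_mul]

lemma halfBoundedToCoind_surjective {φ : G →* Multiplicative ℤ} (N : Subgroup G)
    (hN : N = φ.ker) {s : G} (hs : φ s = Multiplicative.ofAdd 1) :
    Function.Surjective (halfBoundedToCoind φ N hN.le) := by
  intro ⟨f, hf⟩
  refine ⟨⟨(fun m ↦ if 0 ≤ m then f (s ^ m) else 0, fun m ↦ if 0 ≤ m then 0 else f (s ^ m)),
    ⟨0, fun m hm ↦ if_neg (by omega)⟩, ⟨0, fun m hm ↦ if_pos (by omega)⟩⟩, ?_⟩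
  ext g
  have hmem : g * (s ^ (φ g).toAdd)⁻¹ ∈ N := by
    rw [hN, MonoidHom.mem_ker, map_mul, map_inv, map_zpow, hs, mul_inv_eq_one]
    simp [← ofAdd_zsmul]
  have key : f g = f (s ^ (φ g).toAdd) := by
    have := hf ⟨_, hmem⟩ (s ^ (φ g).toAdd)
    simpa using this
  change (if _ then _ else _) + (if _ then _ else _) = f g
  rw [key]
  split_ifs <;> simp

end Shift

section Laurent

/-- The coefficient sequence of a Laurent polynomial, reversed and with alternating signs, so that
multiplication by `-T` becomes translation. -/
def signedCoeff (x : LaurentPolynomial ℤ) (m : ℤ) : ℤ := m.negOnePow * x.coeff (-m)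

lemma signedCoeff_neg_T_mul (x : LaurentPolynomial ℤ) (m : ℤ) :
    signedCoeff (-(LaurentPolynomial.T 1) * x) m = signedCoeff x (m + 1) := by
  have h : (LaurentPolynomial.T 1 * x).coeff (-m) = x.coeff (-(m + 1)) := by
    rw [LaurentPolynomial.T]
    have := AddMonoidAlgebra.coeff_single_mul_add x (1 : ℤ) (1 : ℤ) (-(m + 1))
    simpa using this
  rw [signedCoeff, neg_mul, AddMonoidAlgebra.coeff_neg, Finsupp.neg_apply, h, signedCoeff,
    Int.negOnePow_succ]
  simp

lemma signedCoeff_smul (r : ℤ) (x : LaurentPolynomial ℤ) (m : ℤ) :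
    signedCoeff (r • x) m = r * signedCoeff x m := by
  rw [signedCoeff, AddMonoidAlgebra.coeff_smul, Finsupp.smul_apply, smul_eq_mul, mul_left_comm]
  rfl

lemma exists_bound_signedCoeff (x : LaurentPolynomial ℤ) :
    ∃ N, ∀ m, N < |m| → signedCoeff x m = 0 := by
  refine ⟨∑ i ∈ x.coeff.support, |i|, fun m hm ↦ ?_⟩
  have : -m ∉ x.coeff.support := fun h ↦ by
    have := Finset.single_le_sum (f := fun i : ℤ ↦ |i|) (fun i _ ↦ abs_nonneg i) h
    simp only [abs_neg] at this
    omega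
  simp [signedCoeff, Finsupp.notMem_support_iff.1 this]

/-- The antidiagonal embedding of Laurent polynomials into pairs of half-bounded sequences. -/
def laurentToHalfBounded : LaurentPolynomial ℤ →ₗ[ℤ] halfBoundedPairs where
  toFun x := ⟨(signedCoeff x, -signedCoeff x), by
    obtain ⟨N, hN⟩ := exists_bound_signedCoeff x
    refine ⟨⟨-N, fun m hm ↦ hN m ?_⟩, ⟨N, fun m hm ↦ ?_⟩⟩
    · exact lt_abs.2 (Or.inr (by omega))
    · simp [hN m (lt_abs.2 (Or.inl hm))]⟩
  map_add' x y := halfBoundedPairs_ext (fun m ↦ by simp [signedCoeff, mul_add])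
    (fun m ↦ by simp [signedCoeff, mul_add, add_comm])
  map_smul' r x := halfBoundedPairs_ext (fun m ↦ signedCoeff_smul r x m)
    (fun m ↦ (congrArg Neg.neg (signedCoeff_smul r x m)).trans (mul_neg _ _).symm)

lemma laurentToHalfBounded_fst (x : LaurentPolynomial ℤ) :
    (laurentToHalfBounded x).1.1 = signedCoeff x := rfl

lemma laurentToHalfBounded_snd (x : LaurentPolynomial ℤ) :
    (laurentToHalfBounded x).1.2 = -signedCoeff x := rfl

lemma laurentToHalfBounded_neg_T_mul (x : LaurentPolynomial ℤ) :
    laurentToHalfBounded (-(LaurentPolynomial.T 1) * x) =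
      halfBoundedShift 1 (laurentToHalfBounded x) :=
  halfBoundedPairs_ext
    (fun m ↦ by
      rw [halfBoundedShift_fst, laurentToHalfBounded_fst, laurentToHalfBounded_fst,
        signedCoeff_neg_T_mul])
    (fun m ↦ by
      rw [halfBoundedShift_snd, laurentToHalfBounded_snd, laurentToHalfBounded_snd,
        Pi.neg_apply, Pi.neg_apply, signedCoeff_neg_T_mul])

lemma laurentToHalfBounded_injective : Function.Injective laurentToHalfBounded := by
  intro x y h
  refine LaurentPolynomial.ext fun m ↦ ?_
  have := congrFun (congrArg (fun p : halfBoundedPairs ↦ p.1.1) h) (-m)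
  simpa [laurentToHalfBounded_fst, signedCoeff] using this

lemma exists_laurentToHalfBounded_eq {p : halfBoundedPairs} (hp : ∀ m, p.1.1 m + p.1.2 m = 0) :
    ∃ x, laurentToHalfBounded x = p := by
  obtain ⟨⟨a, ha⟩, ⟨b, hb⟩⟩ := p.2
  let f : ℤ →₀ ℤ := Finsupp.onFinset (Finset.Icc (-b) (-a)) (fun n ↦ n.negOnePow * p.1.1 (-n)) <| by
    intro n hn
    have hn' : p.1.1 (-n) ≠ 0 := right_ne_zero_of_mul hn
    rw [Finset.mem_Icc]
    constructor
    · by_contra h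
      refine hn' ?_
      have := hp (-n)
      rwa [hb (-n) (by omega), add_zero] at this
    · by_contra h
      exact hn' (ha _ (by omega))
  have hf : ∀ m, signedCoeff (.ofCoeff f) m = p.1.1 m := fun m ↦ by
    simp [signedCoeff, f, ← mul_assoc]
  refine ⟨.ofCoeff f, halfBoundedPairs_ext hf fun m ↦ ?_⟩
  rw [laurentToHalfBounded_snd, Pi.neg_apply, hf]
  linarith [hp m]

end Laurent

namespace Representation

/-- A linear map commuting with the action of a generating set is intertwining. -/
lemma intertwines_of_closure_eq_top {k G V W : Type*} [CommRing k] [Group G] [AddCommGroup V]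
    [Module k V] [AddCommGroup W] [Module k W] (ρ : Representation k G V)
    (τ : Representation k G W) (f : V →ₗ[k] W) {S : Set G} (hS : Subgroup.closure S = ⊤)
    (h : ∀ s ∈ S, ∀ x, f (ρ s x) = τ s (f x)) (g : G) (x : V) : f (ρ g x) = τ g (f x) := by
  have hg : g ∈ Subgroup.closure S := hS ▸ Subgroup.mem_top g
  induction hg using Subgroup.closure_induction generalizing x with
  | mem s hs => exact h s hs x
  | one => simp
  | mul a b _ _ iha ihb => simp [iha, ihb]
  | inv a _ ih =>
    have := ih (ρ a⁻¹ x)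
    rw [self_inv_apply] at this
    rw [this, inv_self_apply]

end Representation

open CategoryTheory in
/-- If `G` is generated by `S`, the kernel of `φ : G → ℤ` is `N`, `φ` is `1` on `S`, and some
central element has positive image, then the cohomology of `G` with coefficients in Laurent
polynomials, on which each `s ∈ S` acts by `-T`, is the shifted cohomology of `N`. -/
theorem nonempty_groupCohomology_laurent_equiv_s17 {G : Type} [Group G] (φ : G →* Multiplicative ℤ)
    {S : Set G} (hS : Subgroup.closure S = ⊤) (hφ : ∀ s ∈ S, φ s = Multiplicative.ofAdd 1)
    (hne : S.Nonempty) (N : Subgroup G) (hN : N = φ.ker) (z : Subgroup.center G)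
    (hz : 0 < (φ z).toAdd) (ρ : Representation ℤ G (LaurentPolynomial ℤ))
    (hρ : ∀ s ∈ S, ∀ x, ρ s x = -(LaurentPolynomial.T 1) * x) (j : ℕ) :
    Nonempty (groupCohomology (Rep.of ρ) (j + 1) ≃+
      groupCohomology (Rep.trivial ℤ N ℤ) j) := by
  obtain ⟨s, hs⟩ := hne
  let ι : ρ.IntertwiningMap (halfBoundedRep φ) :=
    laurentToHalfBounded.intertwiningMap_of_isIntertwiningMap _ _ <|
      Representation.intertwines_of_closure_eq_top _ _ _ hS fun s hs x ↦ by
        rw [hρ s hs, laurentToHalfBounded_neg_T_mul]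
        simp [halfBoundedRep, hφ s hs]
  let π := halfBoundedToCoind φ N hN.le
  have hφsurj : ∀ m : ℤ, φ (s ^ m) = Multiplicative.ofAdd m := fun m ↦ by
    rw [map_zpow, hφ s hs, ← ofAdd_zsmul, smul_eq_mul, mul_one]
  let X : ShortComplex (Rep ℤ G) := ShortComplex.mk (Rep.ofHom ι) (Rep.ofHom π) <| by
    refine Rep.hom_ext <| Representation.IntertwiningMap.ext <|
      LinearMap.ext fun x ↦ Subtype.ext <| funext fun g ↦ ?_
    exact add_neg_cancel (signedCoeff x (φ g).toAdd)
  have hX : X.ShortExact := {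
    exact := Rep.exact_of_forall_exists <| by
      intro (p : halfBoundedPairs) (hp : π p = 0)
      refine exists_laurentToHalfBounded_eq fun m ↦ ?_
      have : p.1.1 (φ (s ^ m)).toAdd + p.1.2 (φ (s ^ m)).toAdd = 0 :=
        congrFun (congrArg Subtype.val hp) (s ^ m)
      simpa only [hφsurj, toAdd_ofAdd] using this
    mono_f := (Rep.mono_iff_injective _).2 laurentToHalfBounded_injective
    epi_g := (Rep.epi_iff_surjective _).2 (halfBoundedToCoind_surjective N hN (hφ s hs)) }
  have hzero : ∀ n, Limits.IsZero (groupCohomology X.X₂ n) :=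
    groupCohomology.isZero_of_central_sub_one_bijective _ z (halfBoundedShift_sub_bijective hz)
  have := groupCohomology.isIso_δ_of_isZero hX j (hzero j) (hzero (j + 1))
  exact ⟨((asIso (groupCohomology.δ hX j (j + 1) rfl)).symm ≪≫
    groupCohomology.coindIso (Rep.trivial ℤ N ℤ) j).toLinearEquiv.toAddEquiv⟩

namespace BraidThree

lemma gen_rel : braidGen 3 0 * braidGen 3 1 * braidGen 3 0 =
    braidGen 3 1 * braidGen 3 0 * braidGen 3 1 := by
  have h := PresentedGroup.mk_eq_mk_of_mul_inv_mem
    (rels := artinRels (CoxeterMatrix.A 2)) (x := braidWord 0 1 3) (y := braidWord 1 0 3)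
    ⟨0, 1, by decide, by simp [CoxeterMatrix.A], by simp [CoxeterMatrix.A]⟩
  simp only [braidWord, List.range_succ] at h
  simp only [mul_assoc]
  simp at h
  exact h

lemma closure_range_gen : Subgroup.closure (Set.range (braidGen 3)) = ⊤ :=
  PresentedGroup.closure_range_of _

lemma lift_const_braidWord {B H : Type*} [Group H] (h : H) (s t : B) (m : ℕ) :
    FreeGroup.lift (fun _ ↦ h) (braidWord s t m) = h ^ m := by
  have hf : (FreeGroup.lift (fun _ : B ↦ h)) ∘
      (fun i : ℕ ↦ if i % 2 = 0 then FreeGroup.of s else FreeGroup.of t) = fun _ ↦ h := by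
    funext i
    dsimp only [Function.comp_apply]
    split_ifs <;> simp
  rw [braidWord, map_list_prod, List.map_map, hf]
  simp

/-- Homomorphisms out of `B₃` sending both generators to the same element. -/
def liftConst {H : Type*} [Group H] (h : H) : BraidGroup 3 →* H :=
  PresentedGroup.toGroup (rels := artinRels (CoxeterMatrix.A 2)) (f := fun _ ↦ h) <| by
    rintro _ ⟨s, t, -, -, rfl⟩
    rw [map_mul, map_inv, lift_const_braidWord, lift_const_braidWord, mul_inv_cancel]

lemma liftConst_gen {H : Type*} [Group H] (h : H) (s : Fin 2) :
    liftConst h (braidGen 3 s) = h :=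
  PresentedGroup.toGroup.of _

/-- The length homomorphism `B₃ → ℤ`. -/
def length : BraidGroup 3 →* Multiplicative ℤ := liftConst (Multiplicative.ofAdd 1)

lemma length_gen (s : Fin 2) : length (braidGen 3 s) = Multiplicative.ofAdd 1 :=
  liftConst_gen _ s

lemma abelianization_of_gen (s : Fin 2) :
    Abelianization.of (braidGen 3 s) = Abelianization.of (braidGen 3 0) := by
  have h := congrArg Abelianization.of gen_rel
  simp only [map_mul] at h
  rw [mul_comm (Abelianization.of (braidGen 3 1))] at h
  match s with
  | 0 => rfl
  | 1 => exact (mul_left_cancel h).symm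

lemma commutator_eq_ker_length : commutator (BraidGroup 3) = length.ker := by
  refine le_antisymm (Abelianization.commutator_subset_ker length) fun g hg ↦ ?_
  rw [← Abelianization.ker_of, MonoidHom.mem_ker]
  have h : (Abelianization.of : BraidGroup 3 →* _) =
      (zpowersHom _ (Abelianization.of (braidGen 3 0))).comp length :=
    MonoidHom.eq_of_eqOn_dense closure_range_gen <| by
      rintro _ ⟨s, rfl⟩
      simp [length_gen, abelianization_of_gen s]
  rw [h, MonoidHom.comp_apply, MonoidHom.mem_ker.1 hg, map_one]

/-- The square of the Garside element. -/
def fullTwist : BraidGroup 3 := (braidGen 3 0 * braidGen 3 1 * braidGen 3 0) ^ 2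

lemma fullTwist_mem_center : fullTwist ∈ Subgroup.center (BraidGroup 3) := by
  have h₀ : braidGen 3 0 * (braidGen 3 0 * braidGen 3 1 * braidGen 3 0) =
      (braidGen 3 0 * braidGen 3 1 * braidGen 3 0) * braidGen 3 1 := by
    nth_rewrite 1 [gen_rel]
    simp only [mul_assoc]
  have h₁ : braidGen 3 1 * (braidGen 3 0 * braidGen 3 1 * braidGen 3 0) =
      (braidGen 3 0 * braidGen 3 1 * braidGen 3 0) * braidGen 3 0 := by
    nth_rewrite 2 [gen_rel]
    simp only [mul_assoc]
  rw [← Subgroup.centralizer_univ, ← Subgroup.coe_top, ← closure_range_gen,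
    Subgroup.centralizer_closure, Subgroup.mem_centralizer_iff]
  rintro _ ⟨s, rfl⟩
  rw [fullTwist, sq]
  match s with
  | 0 => rw [← mul_assoc, h₀, mul_assoc, h₁]; simp only [mul_assoc]
  | 1 => rw [← mul_assoc, h₁, mul_assoc, h₀]; simp only [mul_assoc]

lemma length_fullTwist : (length fullTwist).toAdd = 6 := by
  simp [fullTwist, length_gen]

end BraidThree

theorem braid3_cohomology_commutator_shift
    (j : ℕ)
    (ρ : Representation ℤ (BraidGroup 3) (LaurentPolynomial ℤ))
    (hρ : ∀ (s : Fin 2) (x : LaurentPolynomial ℤ),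
      (ρ (braidGen 3 s)) x = -(LaurentPolynomial.T 1) * x) :
    Nonempty ((groupCohomology (Rep.of ρ) (j + 1)) ≃+
      (groupCohomology (Rep.trivial ℤ (↥(commutator (BraidGroup 3))) ℤ) j)) := by
  refine nonempty_groupCohomology_laurent_equiv_s17 BraidThree.length BraidThree.closure_range_gen
    ?_ ⟨_, 0, rfl⟩ _ BraidThree.commutator_eq_ker_length
    ⟨_, BraidThree.fullTwist_mem_center⟩ ?_ ρ ?_ j
  · rintro _ ⟨s, rfl⟩
    exact BraidThree.length_gen s
  · exact BraidThree.length_fullTwist.symm ▸ (by norm_num)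
  · rintro _ ⟨s, rfl⟩ x
    exact hρ s x
end
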